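/- arXiv:1012.1008 — 7 statements merged into one kernel-verified Lean document; each statement's English description precedes it below -/
import Mathlib

section
/- Let n ≥ 2 and k ≥ 1 be integers. For each multi-index α ∈ ℕⁿ with |α| = k let Q_α ∈ ℂ[s₁,…,sₙ] be a polynomial. Assume that for every σ ∈ ℂⁿ there exists c ∈ ℂ such that Q_α(σ) = c·σ^α for every α with |α| = k. Then there exists a polynomial R ∈ ℂ[s₁,…,sₙ] such that Q_α = s^α·R for every α with |α| = k. -/
open MvPolynomial

theorem stmt_7 (n k : ℕ) (hn : 2 ≤ n) (hk : 1 ≤ k)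
    (Q : (Fin n → ℕ) → MvPolynomial (Fin n) ℂ)
    (h : ∀ σ : Fin n → ℂ, ∃ c : ℂ, ∀ α : Fin n → ℕ, ∑ i, α i = k →
      MvPolynomial.eval σ (Q α) = c * ∏ i, σ i ^ α i) :
    ∃ R : MvPolynomial (Fin n) ℂ, ∀ α : Fin n → ℕ, ∑ i, α i = k →
      Q α = (∏ i, (MvPolynomial.X i : MvPolynomial (Fin n) ℂ) ^ α i) * R := by
  have cross : ∀ α β : Fin n → ℕ, ∑ i, α i = k → ∑ i, β i = k →
      (∏ i, (X i : MvPolynomial (Fin n) ℂ) ^ β i) * Q α =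
        (∏ i, (X i : MvPolynomial (Fin n) ℂ) ^ α i) * Q β := by
    intro α β hα hβ
    refine MvPolynomial.funext fun σ => ?_
    obtain ⟨c, hc⟩ := h σ
    simp only [map_mul, map_prod, map_pow, eval_X, hc α hα, hc β hβ]
    ring
  have single_sum (j : Fin n) : ∑ i, (Pi.single j k : Fin n → ℕ) i = k := by simp
  have single_prod (j : Fin n) :
      ∏ i, (X i : MvPolynomial (Fin n) ℂ) ^ (Pi.single j k : Fin n → ℕ) i = X j ^ k := by
    rw [Finset.prod_eq_single j] <;> simp +contextual
  let a : Fin n := ⟨0, by omega⟩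
  let b : Fin n := ⟨1, by omega⟩
  have hX : Prime (X a : MvPolynomial (Fin n) ℂ) := X_prime
  have not_dvd : ¬ (X a : MvPolynomial (Fin n) ℂ) ∣ X b ^ k := fun hdvd => by
    have := hX.dvd_of_dvd_pow hdvd
    simp [X_dvd_X, a, b] at this
  obtain ⟨R, hR⟩ : (X a : MvPolynomial (Fin n) ℂ) ^ k ∣ Q (Pi.single a k) := by
    refine hX.pow_dvd_of_dvd_mul_left k not_dvd ⟨Q (Pi.single b k), ?_⟩
    simpa only [single_prod] using cross _ _ (single_sum a) (single_sum b)
  refine ⟨R, fun β hβ => mul_left_cancel₀ (pow_ne_zero k hX.ne_zero) ?_⟩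
  have key := cross _ β (single_sum a) hβ
  rw [single_prod, hR] at key
  rw [← key]
  ring
end

section
/- Let n ≥ 2 and k ≥ 1 be integers. For each multi-index α ∈ ℕⁿ with |α| = k let Q_α ∈ ℂ[s₁,…,sₙ] be a polynomial, and assume that s^β·Q_α = s^α·Q_β for all multi-indices α, β with |α| = |β| = k. Then there exists a polynomial R ∈ ℂ[s₁,…,sₙ] such that Q_α = s^α·R for every α with |α| = k. -/
open MvPolynomial

theorem prod_X_pow_single {σ R : Type*} [Fintype σ] [DecidableEq σ] [CommSemiring R]
    (i : σ) (k : ℕ) :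
    ∏ j, (X j : MvPolynomial σ R) ^ (Pi.single i k : σ → ℕ) j = X i ^ k := by
  rw [Finset.prod_eq_single i (fun j _ hj => by simp [hj]) (by simp), Pi.single_eq_same]

theorem X_pow_dvd_of_X_pow_mul_eq {σ R : Type*} [CommRing R] [IsDomain R] {i j : σ}
    (hij : i ≠ j) {k l : ℕ} {p q : MvPolynomial σ R} (h : X j ^ l * p = X i ^ k * q) :
    X i ^ k ∣ p := by
  have hX : Prime (X i : MvPolynomial σ R) := X_prime
  refine hX.pow_dvd_of_dvd_mul_left k (fun hd => hij ?_) ⟨q, h⟩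
  exact X_dvd_X.mp (hX.dvd_of_dvd_pow hd)

theorem stmt_8 (n k : ℕ) (hn : 2 ≤ n) (hk : 1 ≤ k)
    (Q : (Fin n → ℕ) → MvPolynomial (Fin n) ℂ)
    (h : ∀ α β : Fin n → ℕ, ∑ i, α i = k → ∑ i, β i = k →
      (∏ i, (MvPolynomial.X i : MvPolynomial (Fin n) ℂ) ^ β i) * Q α
        = (∏ i, (MvPolynomial.X i : MvPolynomial (Fin n) ℂ) ^ α i) * Q β) :
    ∃ R : MvPolynomial (Fin n) ℂ, ∀ α : Fin n → ℕ, ∑ i, α i = k →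
      Q α = (∏ i, (MvPolynomial.X i : MvPolynomial (Fin n) ℂ) ^ α i) * R := by
  have : Nontrivial (Fin n) := Fin.nontrivial_iff_two_le.mpr hn
  obtain ⟨a, b, hab⟩ := exists_pair_ne (Fin n)
  have hsum (i : Fin n) : ∑ j, (Pi.single i k : Fin n → ℕ) j = k := by simp
  have hcross := h _ _ (hsum a) (hsum b)
  rw [prod_X_pow_single, prod_X_pow_single] at hcross
  obtain ⟨R, hR⟩ := X_pow_dvd_of_X_pow_mul_eq hab hcross
  refine ⟨R, fun α hα => ?_⟩
  have hα' := h α _ hα (hsum a)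
  rw [prod_X_pow_single, hR, mul_left_comm] at hα'
  exact mul_left_cancel₀ (pow_ne_zero k (X_ne_zero a)) hα'
end

section
/- Let n ≥ 2 and κ ≥ 2 be integers and let j be an index with 2 ≤ j ≤ n. Let P, Q ∈ ℂ[s₁,…,sₙ] be polynomials whose degrees in the variable s₁ are at most κ − 2. Assume that s₁^κ divides (1 − κ)·P·s_j + κ·Q·s₁ and that s₁^(κ−1) divides (2 − κ)·P·s_j + (κ − 1)·Q·s₁, where 1 − κ, κ, 2 − κ, κ − 1 are interpreted in ℂ. Then P = 0 and Q = 0. -/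
open MvPolynomial

theorem MvPolynomial.eq_zero_of_X_pow_dvd_of_degreeOf_lt {σ R : Type*} [CommRing R]
    {i : σ} {k : ℕ} {p : MvPolynomial σ R} (hdvd : X i ^ k ∣ p) (hdeg : p.degreeOf i < k) :
    p = 0 := by
  obtain ⟨q, rfl⟩ := hdvd
  rcases eq_or_ne q 0 with rfl | hq
  · rw [mul_zero]
  · rw [mul_comm, degreeOf_mul_X_self_pow_eq_add_of_ne_zero i k hq] at hdeg
    omega

theorem stmt_9 (n κ : ℕ) (hn : 2 ≤ n) (hκ : 2 ≤ κ)
    (j : Fin n) (hj : 1 ≤ (j : ℕ))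
    (P Q : MvPolynomial (Fin n) ℂ)
    (hP : P.degreeOf ⟨0, by omega⟩ ≤ κ - 2)
    (hQ : Q.degreeOf ⟨0, by omega⟩ ≤ κ - 2)
    (hdiv1 : (MvPolynomial.X ⟨0, by omega⟩ : MvPolynomial (Fin n) ℂ) ^ κ ∣
      C (1 - (κ : ℂ)) * P * MvPolynomial.X j
        + C (κ : ℂ) * Q * MvPolynomial.X ⟨0, by omega⟩)
    (hdiv2 : (MvPolynomial.X ⟨0, by omega⟩ : MvPolynomial (Fin n) ℂ) ^ (κ - 1) ∣
      C (2 - (κ : ℂ)) * P * MvPolynomial.X j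
        + C ((κ : ℂ) - 1) * Q * MvPolynomial.X ⟨0, by omega⟩) :
    P = 0 ∧ Q = 0 := by
  have hne : (⟨0, by omega⟩ : Fin n) ≠ j := fun h => by simp [← h] at hj
  generalize (⟨0, by omega⟩ : Fin n) = i at *
  have hrel : C (1 - (κ : ℂ)) * P * X j + C (κ : ℂ) * Q * X i = 0 := by
    refine eq_zero_of_X_pow_dvd_of_degreeOf_lt hdiv1 ?_
    refine (degreeOf_add_le _ _ _).trans_lt (max_lt ?_ ?_)
    · rw [degreeOf_mul_X_of_ne _ hne]
      have := degreeOf_C_mul_le P i (1 - (κ : ℂ))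
      omega
    · have := degreeOf_mul_X_self i (C (κ : ℂ) * Q)
      have := degreeOf_C_mul_le Q i (κ : ℂ)
      omega
  have hPX : P * X j = 0 := by
    refine eq_zero_of_X_pow_dvd_of_degreeOf_lt (i := i) (k := κ - 1) ?_ ?_
    · have hcomb : P * X j = C (κ : ℂ) * (C (2 - (κ : ℂ)) * P * X j
          + C ((κ : ℂ) - 1) * Q * X i) := by
        simp only [map_sub, map_one, map_ofNat] at hrel ⊢
        linear_combination (1 - C (κ : ℂ)) * hrel
      rw [hcomb]
      exact hdiv2.mul_left _
    · rw [degreeOf_mul_X_of_ne _ hne]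
      omega
  have hP0 : P = 0 := (mul_eq_zero.mp hPX).resolve_right (X_ne_zero j)
  have hκ0 : κ ≠ 0 := by omega
  subst hP0
  simpa [X_ne_zero, hκ0] using hrel
end

section
/- Let n ≥ 2 and κ ≥ 2 be integers. For each multi-index α ∈ ℕⁿ with |α| = κ let P_α ∈ ℂ[s₁,…,sₙ] be a polynomial. Assume that the degree in s₁ of P_{(κ)} is at most κ − 2 and that for every j with 2 ≤ j ≤ n the degree in s₁ of P_{(κ−1;j)} is at most κ − 2. Assume moreover that for every s ∈ ℂⁿ with s₁ ≠ 0 there exist complex numbers a₂, …, aₙ, c such that, for every α with |α| = κ, Σ_{i=2}^{n} a_i·α_i·s^{α−e_i} + P_α(s) = c·s^α. Then P_α = 0 for every α with |α| = κ. -/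
open MvPolynomial

namespace MvPolynomial

variable {σ : Type*} {R : Type*} [CommRing R]

theorem degreeOf_C_mul_X_pow_mul_le {o j : σ} (hj : j ≠ o) (r : R) (k : ℕ)
    (p : MvPolynomial σ R) : (C r * X j ^ k * p).degreeOf o ≤ p.degreeOf o := by
  refine (degreeOf_mul_le _ _ _).trans ?_
  have := (degreeOf_C_mul_le (X j ^ k) o r).trans (degreeOf_X_pow_of_ne k hj.symm).le
  omega

variable [IsDomain R]

/-- Polynomials over an infinite domain that agree off a coordinate hyperplane are equal. -/
theorem eq_of_eval_eq_of_coord_ne_zero [Infinite R] {p q : MvPolynomial σ R} (o : σ)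
    (h : ∀ s : σ → R, s o ≠ 0 → eval s p = eval s q) : p = q := by
  refine mul_left_cancel₀ (X_ne_zero (R := R) o) (funext fun s => ?_)
  by_cases hs : s o = 0
  · simp [hs]
  · simp [h s hs]

/-- If `X o ^ m` divides a polynomial whose degree in `X o` is less than `m`, the quotient
vanishes. -/
theorem eq_zero_of_X_pow_mul_eq_of_degreeOf_lt {o : σ} {m : ℕ} {p q : MvPolynomial σ R}
    (h : X o ^ m * p = q) (hq : q.degreeOf o < m) : p = 0 := by
  by_contra hp
  rw [← h, degreeOf_mul_eq (pow_ne_zero _ (X_ne_zero o)) hp, degreeOf_X_self_pow] at hq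
  omega

end MvPolynomial

section EdgeExponent

variable {σ : Type*} [DecidableEq σ]

/-- The multi-index `m e_o + k e_j`, for `j ≠ o`. -/
def edgeExponent (o j : σ) (m k : ℕ) : σ → ℕ :=
  fun i => if i = o then m else if i = j then k else 0

theorem edgeExponent_zero (o j : σ) (m : ℕ) :
    edgeExponent o j m 0 = fun i => if i = o then m else 0 := by
  funext i
  simp [edgeExponent]

variable [Fintype σ]

theorem sum_edgeExponent {o j : σ} (hj : j ≠ o) (m k : ℕ) :
    ∑ i, edgeExponent o j m k i = m + k := by
  rw [Fintype.sum_eq_add o j hj.symm fun x hx => by simp [edgeExponent, hx.1, hx.2]]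
  simp [edgeExponent, hj]

theorem prod_pow_edgeExponent {o j : σ} (hj : j ≠ o) (m k : ℕ) (s : σ → ℂ) :
    ∏ l, s l ^ edgeExponent o j m k l = s o ^ m * s j ^ k := by
  rw [Fintype.prod_eq_mul o j hj.symm fun x hx => by simp [edgeExponent, hx.1, hx.2]]
  simp [edgeExponent, hj]

theorem sum_deriv_edgeExponent {o j : σ} (hj : j ≠ o) (m k : ℕ) (a s : σ → ℂ) :
    ∑ i with i ≠ o, a i * (edgeExponent o j m k i : ℂ) *
        ∏ l, s l ^ (edgeExponent o j m k l - if l = i then 1 else 0) =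
      a j * k * (s o ^ m * s j ^ (k - 1)) := by
  rw [Finset.sum_eq_single j]
  · rw [Fintype.prod_eq_mul o j hj.symm fun x hx => by simp [edgeExponent, hx.1, hx.2]]
    simp [edgeExponent, hj, hj.symm]
  · intro i hi hij
    simp [edgeExponent, hij, (Finset.mem_filter.mp hi).2]
  · simp [hj]

variable {κ : ℕ} {P : (σ → ℕ) → MvPolynomial σ ℂ} {o : σ}

/-- Eliminating `a` and `c` from the relations at `κ e_o`, `(κ - 1) e_o + e_j` and
`(κ - k) e_o + k e_j`. -/
theorem X_pow_mul_edgeExponent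
    (h : ∀ s : σ → ℂ, s o ≠ 0 → ∃ a : σ → ℂ, ∃ c : ℂ, ∀ α : σ → ℕ, ∑ i, α i = κ →
      (∑ i with i ≠ o, a i * (α i : ℂ) * ∏ l, s l ^ (α l - if l = i then 1 else 0))
        + eval s (P α) = c * ∏ l, s l ^ α l)
    {j : σ} (hj : j ≠ o) {k : ℕ} (hk : 1 ≤ k) (hkκ : k ≤ κ) :
    X o ^ k * P (edgeExponent o j (κ - k) k) =
      X j ^ (k - 1) * (C (1 - k : ℂ) * P (edgeExponent o j κ 0) * X j +
        C (k : ℂ) * X o * P (edgeExponent o j (κ - 1) 1)) := by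
  refine eq_of_eval_eq_of_coord_ne_zero o fun s hs => ?_
  obtain ⟨a, c, hac⟩ := h s hs
  have key : ∀ r ≤ κ, a j * r * (s o ^ (κ - r) * s j ^ (r - 1)) +
      eval s (P (edgeExponent o j (κ - r) r)) = c * (s o ^ (κ - r) * s j ^ r) := by
    intro r hr
    have := hac (edgeExponent o j (κ - r) r) (by rw [sum_edgeExponent hj]; omega)
    rwa [sum_deriv_edgeExponent hj, prod_pow_edgeExponent hj] at this
  have h0 := key 0 (by omega)
  have h1 := key 1 (by omega)
  have h2 := key k hkκ
  simp only [Nat.cast_zero, Nat.cast_one, Nat.sub_zero, Nat.sub_self, pow_zero, pow_one] at h0 h1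
  simp only [map_mul, map_add, map_pow, eval_X, eval_C]
  obtain ⟨k, rfl⟩ : ∃ r, k = r + 1 := ⟨k - 1, by omega⟩
  obtain ⟨m, rfl⟩ : ∃ m, κ = m + (k + 1) := ⟨κ - (k + 1), by omega⟩
  simp only [Nat.add_sub_cancel] at h2 ⊢
  rw [show m + (k + 1) - 1 = m + k by omega] at h1 ⊢
  push_cast at h2 ⊢
  linear_combination s o ^ (k + 1) * h2 + s j ^ k * k * s j * h0 - s j ^ k * (k + 1) * s o * h1

theorem eq_zero_of_degreeOf_le (hκ : 2 ≤ κ) {j₀ : σ} (hj₀ : j₀ ≠ o)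
    (hPκ : (P fun i => if i = o then κ else 0).degreeOf o ≤ κ - 2)
    (hPκj : ∀ j, j ≠ o → (P (edgeExponent o j (κ - 1) 1)).degreeOf o ≤ κ - 2)
    (h : ∀ s : σ → ℂ, s o ≠ 0 → ∃ a : σ → ℂ, ∃ c : ℂ, ∀ α : σ → ℕ, ∑ i, α i = κ →
      (∑ i with i ≠ o, a i * (α i : ℂ) * ∏ l, s l ^ (α l - if l = i then 1 else 0))
        + eval s (P α) = c * ∏ l, s l ^ α l)
    {α : σ → ℕ} (hα : ∑ i, α i = κ) : P α = 0 := by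
  have hκ0 : (κ : ℂ) ≠ 0 := by exact_mod_cast (by omega : κ ≠ 0)
  set Q := P fun i => if i = o then κ else 0 with hQ
  have rel : ∀ j, j ≠ o → C (1 - κ : ℂ) * Q * X j +
      C (κ : ℂ) * X o * P (edgeExponent o j (κ - 1) 1) = 0 := by
    intro j hj
    have e := X_pow_mul_edgeExponent h hj (k := κ) (by omega) le_rfl
    rw [edgeExponent_zero, ← hQ] at e
    have hdeg : (X j ^ (κ - 1) * (C (1 - κ : ℂ) * Q * X j +
        C (κ : ℂ) * X o * P (edgeExponent o j (κ - 1) 1))).degreeOf o < κ := by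
      have d1 := degreeOf_C_mul_X_pow_mul_le hj (1 - κ : ℂ) 1 Q
      have d2 := degreeOf_mul_le o (X o : MvPolynomial σ ℂ) (P (edgeExponent o j (κ - 1) 1))
      have d3 := degreeOf_C_mul_le (X o * P (edgeExponent o j (κ - 1) 1)) o (κ : ℂ)
      have d4 := degreeOf_add_le o (C (1 - κ : ℂ) * X j ^ 1 * Q)
        (C (κ : ℂ) * (X o * P (edgeExponent o j (κ - 1) 1)))
      have d5 := degreeOf_C_mul_X_pow_mul_le hj (1 : ℂ) (κ - 1)
        (C (1 - κ : ℂ) * X j ^ 1 * Q + C (κ : ℂ) * (X o * P (edgeExponent o j (κ - 1) 1)))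
      have d6 := hPκj j hj
      have dX : (X o : MvPolynomial σ ℂ).degreeOf o = 1 := by simp
      rw [show X j ^ (κ - 1) * (C (1 - κ : ℂ) * Q * X j +
          C (κ : ℂ) * X o * P (edgeExponent o j (κ - 1) 1)) =
        C (1 : ℂ) * X j ^ (κ - 1) * (C (1 - κ : ℂ) * X j ^ 1 * Q +
          C (κ : ℂ) * (X o * P (edgeExponent o j (κ - 1) 1))) by rw [C_1]; ring]
      omega
    rw [eq_zero_of_X_pow_mul_eq_of_degreeOf_lt e hdeg, mul_zero] at e
    exact (mul_eq_zero.mp e.symm).resolve_left (pow_ne_zero _ (X_ne_zero j))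
  have hQ0 : Q = 0 := by
    have e := X_pow_mul_edgeExponent h hj₀ (k := κ - 1) (by omega) (by omega)
    rw [edgeExponent_zero, ← hQ] at e
    have e' : X o ^ (κ - 1) * (C (κ : ℂ) * P (edgeExponent o j₀ (κ - (κ - 1)) (κ - 1))) =
        C 1 * X j₀ ^ (κ - 1) * Q := by
      have hpow : (X j₀ : MvPolynomial σ ℂ) ^ (κ - 1) = X j₀ ^ (κ - 1 - 1) * X j₀ := by
        rw [← pow_succ]; congr 1; omega
      have r := rel j₀ hj₀
      rw [hpow]
      rw [Nat.cast_sub (by omega)] at e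
      simp only [Nat.cast_one, map_sub, map_one] at e r ⊢
      linear_combination C (κ : ℂ) * e + X j₀ ^ (κ - 1 - 1) * (C (κ : ℂ) - 1) * r
    have hdeg := degreeOf_C_mul_X_pow_mul_le hj₀ (1 : ℂ) (κ - 1) Q
    rw [eq_zero_of_X_pow_mul_eq_of_degreeOf_lt e' (by omega), mul_zero, C_1, one_mul] at e'
    exact (mul_eq_zero.mp e'.symm).resolve_left (pow_ne_zero _ (X_ne_zero j₀))
  have hQj : ∀ j, j ≠ o → P (edgeExponent o j (κ - 1) 1) = 0 := by
    intro j hj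
    have r := rel j hj
    rw [hQ0, mul_zero, zero_mul, zero_add] at r
    exact (mul_eq_zero.mp r).resolve_left
      (mul_ne_zero (C_ne_zero.mpr hκ0) (X_ne_zero o))
  refine eq_of_eval_eq_of_coord_ne_zero o fun s hs => ?_
  obtain ⟨a, c, hac⟩ := h s hs
  have hc : c = 0 := by
    have := hac (edgeExponent o j₀ κ 0) (sum_edgeExponent hj₀ _ _)
    rw [sum_deriv_edgeExponent hj₀, prod_pow_edgeExponent hj₀, edgeExponent_zero, ← hQ, hQ0] at this
    simpa [hs] using this.symm
  have ha : ∀ j, j ≠ o → a j = 0 := by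
    intro j hj
    have := hac (edgeExponent o j (κ - 1) 1) (by rw [sum_edgeExponent hj]; omega)
    rw [sum_deriv_edgeExponent hj, hQj j hj, hc] at this
    simpa [hs] using this
  have := hac α hα
  rw [hc, Finset.sum_eq_zero fun i hi => by simp [ha i (Finset.mem_filter.mp hi).2]] at this
  simpa using this

end EdgeExponent

theorem stmt_10 (n κ : ℕ) (hn : 2 ≤ n) (hκ : 2 ≤ κ)
    (P : (Fin n → ℕ) → MvPolynomial (Fin n) ℂ)
    (hPκ : (P (fun i => if i = ⟨0, by omega⟩ then κ else 0)).degreeOf ⟨0, by omega⟩ ≤ κ - 2)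
    (hPκj : ∀ j : Fin n, 1 ≤ (j : ℕ) →
      (P (fun i => if i = ⟨0, by omega⟩ then κ - 1 else if i = j then 1 else 0)).degreeOf
        ⟨0, by omega⟩ ≤ κ - 2)
    (h : ∀ s : Fin n → ℂ, s ⟨0, by omega⟩ ≠ 0 →
      ∃ a : Fin n → ℂ, ∃ c : ℂ, ∀ α : Fin n → ℕ, ∑ i, α i = κ →
        (∑ i ∈ Finset.univ.filter (fun i : Fin n => 1 ≤ (i : ℕ)),
            a i * (α i : ℂ) * ∏ l, s l ^ (α l - if l = i then 1 else 0))
          + MvPolynomial.eval s (P α) = c * ∏ l, s l ^ α l) :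
    ∀ α : Fin n → ℕ, ∑ i, α i = κ → P α = 0 := by
  have hne : ∀ i : Fin n, 1 ≤ (i : ℕ) ↔ i ≠ ⟨0, by omega⟩ := by
    intro i
    rw [Ne, Fin.ext_iff]
    exact Nat.one_le_iff_ne_zero
  simp only [hne] at h
  intro α hα
  exact eq_zero_of_degreeOf_le hκ (j₀ := ⟨1, by omega⟩) ((hne _).mp le_rfl) hPκ
    (fun j hj => hPκj j ((hne j).mpr hj)) h hα
end

section
/- Let n ≥ 2 and κ ≥ 1 be integers. For each multi-index α ∈ ℕⁿ with |α| = κ let P_α ∈ ℂ[s₁,…,sₙ] be a polynomial. Assume that the degree in s₁ of P_{(κ)} is at most κ − 1, and that for every s ∈ ℂⁿ with s₁ ≠ 0 there exists a complex number c such that P_α(s) = c·s^α for every α with |α| = κ. Then P_α = 0 for every α with |α| = κ. -/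
open MvPolynomial

/-- Two polynomials that agree wherever a fixed nonzero polynomial does not vanish are equal. -/
lemma MvPolynomial.eq_of_eval_eq_of_eval_ne_zero {σ R : Type*} [CommRing R] [IsDomain R]
    [Infinite R] {p q r : MvPolynomial σ R} (hr : r ≠ 0)
    (h : ∀ s, eval s r ≠ 0 → eval s p = eval s q) : p = q := by
  refine mul_left_cancel₀ hr (MvPolynomial.funext fun s => ?_)
  by_cases hs : eval s r = 0
  · simp [hs]
  · simp [h s hs]

theorem stmt_11 (n κ : ℕ) (hn : 2 ≤ n) (hκ : 1 ≤ κ)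
    (P : (Fin n → ℕ) → MvPolynomial (Fin n) ℂ)
    (hPκ : (P (fun i => if i = ⟨0, by omega⟩ then κ else 0)).degreeOf ⟨0, by omega⟩ ≤ κ - 1)
    (h : ∀ s : Fin n → ℂ, s ⟨0, by omega⟩ ≠ 0 →
      ∃ c : ℂ, ∀ α : Fin n → ℕ, ∑ i, α i = κ →
        MvPolynomial.eval s (P α) = c * ∏ l, s l ^ α l) :
    ∀ α : Fin n → ℕ, ∑ i, α i = κ → P α = 0 := by
  set i₀ : Fin n := ⟨0, by omega⟩
  let i₁ : Fin n := ⟨1, by omega⟩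
  have hne : i₀ ≠ i₁ := by simp [i₀, i₁]
  let single (j : Fin n) : Fin n → ℕ := fun i => if i = j then κ else 0
  have sum_single (j : Fin n) : ∑ i, single j i = κ := by simp [single]
  have prod_single (j : Fin n) :
      ∏ l, (X l : MvPolynomial (Fin n) ℂ) ^ single j l = X j ^ κ := by
    simp [single, pow_ite]
  have cross (α β : Fin n → ℕ) (hα : ∑ i, α i = κ) (hβ : ∑ i, β i = κ) :
      P α * ∏ l, X l ^ β l = P β * ∏ l, X l ^ α l := by
    refine eq_of_eval_eq_of_eval_ne_zero (X_ne_zero i₀) fun s hs => ?_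
    obtain ⟨c, hc⟩ := h s (by simpa using hs)
    simp only [map_mul, map_prod, map_pow, eval_X, hc α hα, hc β hβ]
    ring
  have key : P (single i₀) * X i₁ ^ κ = P (single i₁) * X i₀ ^ κ := by
    simpa only [prod_single] using cross _ _ (sum_single i₀) (sum_single i₁)
  have hP₁ : P (single i₁) = 0 := by
    by_contra hP₁
    have hle : degreeOf i₀ (P (single i₀) * X i₁ ^ κ) ≤ κ - 1 := by
      rw [degreeOf_mul_X_pow_of_ne _ hne]
      exact hPκ
    rw [key, degreeOf_mul_X_self_pow_eq_add_of_ne_zero _ _ hP₁] at hle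
    omega
  intro α hα
  have hP₀ : P (single i₀) = 0 := by
    simpa [hP₁, X_ne_zero] using key
  have hmul := cross α (single i₀) hα (sum_single i₀)
  simpa [prod_single, hP₀, X_ne_zero] using hmul
end

section
/- Let n ≥ 2, q ≥ 2 and r be integers with 2 ≤ r ≤ q, and set κ = q + 1 − r. Let P ∈ ℂ[s₁,…,sₙ] be homogeneous of degree q + 1, let P_j ∈ ℂ[s₁,…,sₙ] be homogeneous of degree q + 1 for every j with 2 ≤ j ≤ n, and let P′ ∈ ℂ[s₁,…,sₙ] be homogeneous of degree q + 2. Then there exist a homogeneous polynomial G of degree r and homogeneous polynomials H₁, …, Hₙ of degree r + 1 such that: (i) every monomial of P + s₁^κ·G + κ·s₁^(κ−1)·H₁ has s₁-exponent at most κ − 2; (ii) for every j with 2 ≤ j ≤ n, every monomial of s₁·P_j + s₁^κ·s_j·G + (κ−1)·s₁^(κ−1)·s_j·H₁ + s₁^κ·H_j has s₁-exponent at most κ − 1; (iii) every monomial of P′ + s₁^(κ+1)·G + (κ+1)·s₁^κ·H₁ has s₁-exponent at most κ. -/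
open MvPolynomial

/-- Division with remainder of a homogeneous polynomial by a power of a variable. -/
theorem MvPolynomial.IsHomogeneous.exists_eq_X_pow_mul_add {σ R : Type*} [CommRing R]
    {p : MvPolynomial σ R} {m k : ℕ} (hp : p.IsHomogeneous (m + k)) (i : σ) :
    ∃ a b : MvPolynomial σ R, a.IsHomogeneous m ∧ b.IsHomogeneous (m + k) ∧
      p = X i ^ k * a + b ∧ ∀ d ∈ b.support, d i < k := by
  have hdiv : (p.divMonomial (Finsupp.single i k)).IsHomogeneous m := by
    intro d hd
    rw [coeff_divMonomial] at hd
    have h := hp hd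
    simp only [map_add, Finsupp.weight_single, Pi.one_apply, smul_eq_mul, mul_one] at h
    omega
  have hdecomp : p = X i ^ k * (p.divMonomial (Finsupp.single i k))
      + p.modMonomial (Finsupp.single i k) := by
    rw [X_pow_eq_monomial]
    exact (divMonomial_add_modMonomial p _).symm
  refine ⟨_, _, hdiv, ?_, hdecomp, fun d hd => ?_⟩
  · rw [← sub_eq_iff_eq_add'.mpr hdecomp, add_comm m k]
    rw [add_comm m k] at hp
    exact hp.sub ((isHomogeneous_X_pow i k).mul hdiv)
  · by_contra! h
    exact mem_support_iff.mp hd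
      (coeff_modMonomial_of_le p (Finsupp.single_le_iff.mpr h))

theorem stmt_12 (n q r : ℕ) (hn : 2 ≤ n) (hq : 2 ≤ q) (hr : 2 ≤ r) (hrq : r ≤ q)
    (κ : ℕ) (hκ : κ = q + 1 - r)
    (i₀ : Fin n) (hi₀ : (i₀ : ℕ) = 0)
    (P : MvPolynomial (Fin n) ℂ) (hP : P.IsHomogeneous (q + 1))
    (Pj : Fin n → MvPolynomial (Fin n) ℂ)
    (hPj : ∀ j : Fin n, 1 ≤ (j : ℕ) → (Pj j).IsHomogeneous (q + 1))
    (P' : MvPolynomial (Fin n) ℂ) (hP' : P'.IsHomogeneous (q + 2)) :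
    ∃ G : MvPolynomial (Fin n) ℂ, ∃ H : Fin n → MvPolynomial (Fin n) ℂ,
      G.IsHomogeneous r ∧ (∀ i, (H i).IsHomogeneous (r + 1)) ∧
      (∀ d ∈ (P + MvPolynomial.X i₀ ^ κ * G
          + C (κ : ℂ) * MvPolynomial.X i₀ ^ (κ - 1) * H i₀).support,
        (d i₀ : ℤ) ≤ (κ : ℤ) - 2) ∧
      (∀ j : Fin n, 1 ≤ (j : ℕ) →
        ∀ d ∈ (MvPolynomial.X i₀ * Pj j
            + MvPolynomial.X i₀ ^ κ * MvPolynomial.X j * G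
            + C ((κ : ℂ) - 1) * MvPolynomial.X i₀ ^ (κ - 1) * MvPolynomial.X j * H i₀
            + MvPolynomial.X i₀ ^ κ * H j).support,
          (d i₀ : ℤ) ≤ (κ : ℤ) - 1) ∧
      (∀ d ∈ (P' + MvPolynomial.X i₀ ^ (κ + 1) * G
          + C ((κ : ℂ) + 1) * MvPolynomial.X i₀ ^ κ * H i₀).support,
        (d i₀ : ℤ) ≤ (κ : ℤ)) := by
  obtain ⟨k, rfl⟩ : ∃ k, κ = k + 1 := ⟨κ - 1, by omega⟩
  obtain rfl : q = r + k := by omega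
  have hk : (k : ℂ) + 1 ≠ 0 := by exact_mod_cast k.succ_ne_zero
  obtain ⟨A, R, hA, -, hPA, hR⟩ :=
    (show P.IsHomogeneous ((r + 1) + k) by convert hP using 1; ring).exists_eq_X_pow_mul_add i₀
  obtain ⟨A', A₀, hA', hA₀, hAA, hA₀d⟩ := hA.exists_eq_X_pow_mul_add i₀
  obtain ⟨B, R', hB, -, hPB, hR'⟩ :=
    (show P'.IsHomogeneous (r + (k + 2)) by
      rwa [← add_assoc]).exists_eq_X_pow_mul_add i₀
  have hXP (j : Fin n) : ∃ Q S : MvPolynomial (Fin n) ℂ, Q.IsHomogeneous (r + 1) ∧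
      (1 ≤ (j : ℕ) → X i₀ * Pj j = X i₀ ^ (k + 1) * Q + S ∧ ∀ d ∈ S.support, d i₀ < k + 1) := by
    by_cases hj : 1 ≤ (j : ℕ)
    · obtain ⟨Q, S, hQ, -, h⟩ :=
        (show (X i₀ * Pj j).IsHomogeneous ((r + 1) + (k + 1)) by
          convert (isHomogeneous_X ℂ i₀).mul (hPj j hj) using 1; ring).exists_eq_X_pow_mul_add i₀
      exact ⟨Q, S, hQ, fun _ => h⟩
    · exact ⟨0, 0, isHomogeneous_zero _ _ _, fun h => absurd h hj⟩
  choose Q S hQ hS using hXP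
  have hA₀deg : degreeOf i₀ A₀ = 0 :=
    Nat.le_zero.mp (degreeOf_le_iff.mpr fun d hd => Nat.lt_succ_iff.mp (hA₀d d hd))
  have hXr (j : Fin n) {F : MvPolynomial (Fin n) ℂ} (hF : F.IsHomogeneous r) :
      (X j * F).IsHomogeneous (r + 1) := by
    rw [add_comm]
    exact (isHomogeneous_X ℂ j).mul hF
  set D := A' - B with hD
  have hDr : D.IsHomogeneous r := hA'.sub hB
  set G := -A' - C ((k : ℂ) + 1) * D with hG
  have hGr : G.IsHomogeneous r := hA'.neg.sub (hDr.C_mul _)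
  set H₁ := X i₀ * D - C ((k : ℂ) + 1)⁻¹ * A₀ with hH₁
  have hH₁r : H₁.IsHomogeneous (r + 1) := (hXr i₀ hDr).sub (hA₀.C_mul _)
  have hCC : (C ((k : ℂ) + 1) : MvPolynomial (Fin n) ℂ) * C ((k : ℂ) + 1)⁻¹ = 1 := by
    rw [← C_mul, mul_inv_cancel₀ hk, C_1]
  refine ⟨G, fun j => if j = i₀ then H₁ else -(Q j + X j * G + C (k : ℂ) * (X j * D)),
    hGr, fun j => ?_, fun d hd => ?_, fun j hj d hd => ?_, fun d hd => ?_⟩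
  · dsimp only
    split_ifs
    · exact hH₁r
    · exact (((hQ j).add (hXr j hGr)).add ((hXr j hDr).C_mul _)).neg
  · have key : P + X i₀ ^ (k + 1) * G + C ((k + 1 : ℕ) : ℂ) * X i₀ ^ (k + 1 - 1) * H₁ = R := by
      rw [hPA, hAA, hH₁, hG]
      push_cast
      linear_combination (-X i₀ ^ k * A₀) * hCC
    simp only [if_true] at hd
    rw [key] at hd
    have := hR d hd
    push_cast
    omega
  · have hji : j ≠ i₀ := by
      rintro rfl
      omega
    have key : X i₀ * Pj j + X i₀ ^ (k + 1) * X j * G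
        + C (((k + 1 : ℕ) : ℂ) - 1) * X i₀ ^ (k + 1 - 1) * X j * H₁
        + X i₀ ^ (k + 1) * -(Q j + X j * G + C (k : ℂ) * (X j * D))
        = S j + C (-(k : ℂ) * ((k : ℂ) + 1)⁻¹) * X j * A₀ * X i₀ ^ k := by
      rw [(hS j hj).1, hH₁, Nat.add_sub_cancel, C_mul, C_neg,
        show ((k + 1 : ℕ) : ℂ) - 1 = k by push_cast; ring]
      ring
    simp only [if_true, if_neg hji] at hd
    rw [key] at hd
    have hdeg : degreeOf i₀ (S j + C (-(k : ℂ) * ((k : ℂ) + 1)⁻¹) * X j * A₀ * X i₀ ^ k) ≤ k := by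
      refine (degreeOf_add_le _ _ _).trans (max_le ?_ ?_)
      · exact degreeOf_le_iff.mpr fun e he => Nat.lt_succ_iff.mp ((hS j hj).2 e he)
      · have h₁ := degreeOf_mul_le i₀ (C (-(k : ℂ) * ((k : ℂ) + 1)⁻¹) * X j * A₀) (X i₀ ^ k)
        have h₂ := degreeOf_mul_le i₀ (C (-(k : ℂ) * ((k : ℂ) + 1)⁻¹) * X j) A₀
        have h₃ := degreeOf_C_mul_le (X j) i₀ (-(k : ℂ) * ((k : ℂ) + 1)⁻¹)
        have h₄ := degreeOf_X_of_ne (R := ℂ) hji.symm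
        have h₅ := degreeOf_pow_le i₀ (X i₀ : MvPolynomial (Fin n) ℂ) k
        rw [degreeOf_X_self, mul_one] at h₅
        omega
    have := degreeOf_le_iff.mp hdeg d hd
    push_cast
    omega
  · have key : P' + X i₀ ^ (k + 1 + 1) * G + C (((k + 1 : ℕ) : ℂ) + 1) * X i₀ ^ (k + 1) * H₁
        = R' + C (-((k : ℂ) + 2) * ((k : ℂ) + 1)⁻¹) * A₀ * X i₀ ^ (k + 1) := by
      rw [hPB, hH₁, hG, hD]
      simp only [C_mul, C_neg, C_add, C_1, Nat.cast_add, Nat.cast_one,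
        show (C (2 : ℂ) : MvPolynomial (Fin n) ℂ) = 2 from map_ofNat C 2]
      ring
    simp only [if_true] at hd
    rw [key] at hd
    have hdeg : degreeOf i₀ (R' + C (-((k : ℂ) + 2) * ((k : ℂ) + 1)⁻¹) * A₀ * X i₀ ^ (k + 1))
        ≤ k + 1 := by
      refine (degreeOf_add_le _ _ _).trans (max_le ?_ ?_)
      · exact degreeOf_le_iff.mpr fun e he => Nat.lt_succ_iff.mp (hR' e he)
      · have h₁ := degreeOf_mul_le i₀ (C (-((k : ℂ) + 2) * ((k : ℂ) + 1)⁻¹) * A₀) (X i₀ ^ (k + 1))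
        have h₂ := degreeOf_C_mul_le A₀ i₀ (-((k : ℂ) + 2) * ((k : ℂ) + 1)⁻¹)
        have h₃ := degreeOf_pow_le i₀ (X i₀ : MvPolynomial (Fin n) ℂ) (k + 1)
        rw [degreeOf_X_self, mul_one] at h₃
        omega
    have := degreeOf_le_iff.mp hdeg d hd
    exact_mod_cast this
end

section
/- Let n ≥ 2 and κ ≥ 1 be integers. For each multi-index α ∈ ℕⁿ with |α| = κ let P_α ∈ ℂ[s₁,…,sₙ] be a polynomial. Assume that for every s ∈ ℂⁿ with s₁ ≠ 0 there exist complex numbers a₂, …, aₙ, c such that, for every α with |α| = κ, Σ_{i=2}^{n} a_i·α_i·s^{α−e_i} + P_α(s) = c·s^α. Then for every α with |α| = κ the polynomial identity P_α·s₁^κ = (1 − Σ_{i=2}^{n} α_i)·P_{(κ)}·s^α + Σ_{i=2}^{n} α_i·P_{(κ−1;i)}·s₁·s^{α−e_i} holds in ℂ[s₁,…,sₙ]. -/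
open MvPolynomial

/-- Two polynomials that agree wherever one coordinate is nonzero are equal. -/
theorem MvPolynomial.eq_of_eval_eq_of_coord_ne_zero_s14 {σ R : Type*} [CommRing R] [IsDomain R]
    [Infinite R] (j : σ) {p q : MvPolynomial σ R}
    (h : ∀ s : σ → R, s j ≠ 0 → eval s p = eval s q) : p = q := by
  apply mul_right_cancel₀ (X_ne_zero j : (X j : MvPolynomial σ R) ≠ 0)
  apply MvPolynomial.funext
  intro s
  by_cases hs : s j = 0
  · simp [hs]
  · simp [h s hs]

/-- Multiplying `αᵢ s^(α - eᵢ)` by `sᵢ` gives `αᵢ s^α`. -/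
theorem natCast_mul_prod_pow_sub_single {ι R : Type*} [Fintype ι] [DecidableEq ι]
    [CommSemiring R] (s : ι → R) (α : ι → ℕ) (i : ι) :
    (α i : R) * (s i * ∏ l, s l ^ (α l - if l = i then 1 else 0))
      = α i * ∏ l, s l ^ α l := by
  rcases Nat.eq_zero_or_pos (α i) with h | h
  · simp [h]
  · congr 1
    rw [← Finset.mul_prod_erase _ _ (Finset.mem_univ i),
      ← Finset.mul_prod_erase _ (fun l => s l ^ α l) (Finset.mem_univ i), ← mul_assoc]
    congr 1
    · rw [if_pos rfl, mul_pow_sub_one h.ne']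
    · refine Finset.prod_congr rfl fun l hl => ?_
      rw [if_neg (Finset.ne_of_mem_erase hl), Nat.sub_zero]

theorem stmt_14 (n κ : ℕ) (hn : 2 ≤ n) (hκ : 1 ≤ κ)
    (i₀ : Fin n) (hi₀ : (i₀ : ℕ) = 0)
    (P : (Fin n → ℕ) → MvPolynomial (Fin n) ℂ)
    (h : ∀ s : Fin n → ℂ, s i₀ ≠ 0 →
      ∃ a : Fin n → ℂ, ∃ c : ℂ, ∀ α : Fin n → ℕ, ∑ i, α i = κ →
        (∑ i ∈ Finset.univ.filter (fun i : Fin n => 1 ≤ (i : ℕ)),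
            a i * (α i : ℂ) * ∏ l, s l ^ (α l - if l = i then 1 else 0))
          + MvPolynomial.eval s (P α) = c * ∏ l, s l ^ α l) :
    ∀ α : Fin n → ℕ, ∑ i, α i = κ →
      P α * MvPolynomial.X i₀ ^ κ
        = C (1 - ∑ i ∈ Finset.univ.filter (fun i : Fin n => 1 ≤ (i : ℕ)), (α i : ℂ))
            * P (fun i => if i = i₀ then κ else 0)
            * ∏ l, (MvPolynomial.X l : MvPolynomial (Fin n) ℂ) ^ α l
          + ∑ i ∈ Finset.univ.filter (fun i : Fin n => 1 ≤ (i : ℕ)),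
              C (α i : ℂ)
                * P (fun l => if l = i₀ then κ - 1 else if l = i then 1 else 0)
                * MvPolynomial.X i₀
                * ∏ l, (MvPolynomial.X l : MvPolynomial (Fin n) ℂ)
                    ^ (α l - if l = i then 1 else 0) := by
  intro α hα
  refine MvPolynomial.eq_of_eval_eq_of_coord_ne_zero_s14 i₀ fun s hs => ?_
  obtain ⟨a, c, hac⟩ := h s hs
  have hne : ∀ i : Fin n, 1 ≤ (i : ℕ) → i ≠ i₀ := by
    rintro i hi rfl
    omega
  have eval_pure : eval s (P fun i => if i = i₀ then κ else 0) = c * s i₀ ^ κ := by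
    have key := hac (fun i => if i = i₀ then κ else 0) (by simp)
    rw [Finset.sum_eq_zero, zero_add] at key
    · simpa [pow_ite] using key
    · intro i hi
      simp [hne i (Finset.mem_filter.1 hi).2]
  have eval_mixed : ∀ i : Fin n, 1 ≤ (i : ℕ) →
      eval s (P fun l => if l = i₀ then κ - 1 else if l = i then 1 else 0)
        = c * (s i₀ ^ (κ - 1) * s i) - a i * s i₀ ^ (κ - 1) := by
    intro i hi
    have hi' := hne i hi
    have hβ : (fun l => if l = i₀ then κ - 1 else if l = i then 1 else 0)
        = fun l => (if l = i₀ then κ - 1 else 0) + if l = i then 1 else 0 := by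
      funext l
      by_cases hl : l = i₀
      · simp [hl, hi'.symm]
      · simp [hl]
    rw [hβ]
    have key := hac (fun l => (if l = i₀ then κ - 1 else 0) + if l = i then 1 else 0)
      (by simp [Finset.sum_add_distrib, Nat.sub_add_cancel hκ])
    rw [Finset.sum_eq_single_of_mem i (by simpa using hi)] at key
    · simp only [Nat.add_sub_cancel, pow_add, Finset.prod_mul_distrib, pow_ite, pow_zero,
        pow_one, Finset.prod_ite_eq', Finset.mem_univ, if_true, if_neg hi', zero_add,
        Nat.cast_one, mul_one] at key
      linear_combination key
    · intro j hj hji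
      simp [hne j (Finset.mem_filter.1 hj).2, hji]
  have hκ' : s i₀ ^ (κ - 1) * s i₀ = s i₀ ^ κ := pow_sub_one_mul (by omega) _
  have hsum : ∑ i ∈ Finset.univ.filter (fun i : Fin n => 1 ≤ (i : ℕ)),
      (α i : ℂ) * eval s (P fun l => if l = i₀ then κ - 1 else if l = i then 1 else 0)
        * s i₀ * ∏ l, s l ^ (α l - if l = i then 1 else 0)
      = (∑ i ∈ Finset.univ.filter (fun i : Fin n => 1 ≤ (i : ℕ)), (α i : ℂ))
          * (c * s i₀ ^ κ * ∏ l, s l ^ α l)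
        - s i₀ ^ κ * ∑ i ∈ Finset.univ.filter (fun i : Fin n => 1 ≤ (i : ℕ)),
            a i * (α i : ℂ) * ∏ l, s l ^ (α l - if l = i then 1 else 0) := by
    rw [Finset.sum_mul, Finset.mul_sum, ← Finset.sum_sub_distrib]
    refine Finset.sum_congr rfl fun i hi => ?_
    rw [eval_mixed i (Finset.mem_filter.1 hi).2, ← hκ']
    linear_combination
      c * s i₀ ^ (κ - 1) * s i₀ * natCast_mul_prod_pow_sub_single s α i
  simp only [map_mul, map_add, map_sum, map_prod, map_pow, eval_X, eval_C, hsum, eval_pure]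
  linear_combination s i₀ ^ κ * hac α hα
end
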